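/- Let K ≥ 1, let Q : Fin K × Fin K → ℝ satisfy Q(k,j) > 0 for all k,j and ∑_{j,k} Q(k,j) = 1, with marginals Q⁻_j = ∑_k Q(k,j), Q⁺_k = ∑_j Q(k,j), and let P be a probability distribution on node types (j',k') ∈ {0,…,K}² with z := ∑ k' P⁺_{k'} = ∑ j' P⁻_{j'} > 0. Consider a sequence of node-type systems, indexed by N → ∞, with N nodes of types in {0,…,K}², E(N) = ∑_i k_i = ∑_i j_i edges, node-type counts u_{j'k'}(N), and stub margins e(N), such that u_{j'k'}(N)/N → P_{j'k'} for all (j',k'), E(N)/N → z, and e(N)/E(N) → (Q⁻, Q⁺). Fix a type (j₀,k₀) ∈ {1,…,K}² and for each N fix an edge index ℓ₀(N). Then N times the probability, under the ACG wiring measure ℙ_N, that edge ℓ₀(N) is a self-loop at a node of type (j₀,k₀) converges to j₀ k₀ P_{j₀k₀} Q(k₀,j₀) / ( z² Q⁺_{k₀} Q⁻_{j₀} ). -/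

import Mathlib

open scoped BigOperators Classical

/-- The weight of a wiring `(σ, τ)`. -/
noncomputable def wiringWeight (E : ℕ) (k j : Fin E → ℕ) (Q : ℕ × ℕ → ℝ)
    (σ τ : Equiv.Perm (Fin E)) : ℝ :=
  ∏ ℓ : Fin E, Q (k (σ ℓ), j (τ ℓ))

/-- The ACG normalization constant `C = ∑_{σ,τ} w(σ,τ)`. -/
noncomputable def Cnorm (E : ℕ) (k j : Fin E → ℕ) (Q : ℕ × ℕ → ℝ) : ℝ :=
  ∑ σ : Equiv.Perm (Fin E), ∑ τ : Equiv.Perm (Fin E), wiringWeight E k j Q σ τ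

/-- The number of stubs with degree label `d`. -/
def stubCount (E : ℕ) (f : Fin E → ℕ) (d : ℕ) : ℕ :=
  (Finset.univ.filter fun ℓ => f ℓ = d).card
/-- Single-permutation weight. -/
noncomputable def permW (n : ℕ) (k j : Fin n → ℕ) (Q : ℕ × ℕ → ℝ) (ρ : Equiv.Perm (Fin n)) : ℝ :=
  ∏ s : Fin n, Q (k s, j (ρ s))

/-- Number of edges of type `(a,b)`. -/
noncomputable def edgeCnt (n : ℕ) (k j : Fin n → ℕ) (ρ : Equiv.Perm (Fin n)) (p : ℕ × ℕ) : ℝ :=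
  ∑ s : Fin n, if k s = p.1 ∧ j (ρ s) = p.2 then 1 else 0

lemma sum_perm_apply (n : ℕ) (h : Fin n → ℝ) (l : Fin n) :
    (n : ℝ) * ∑ σ : Equiv.Perm (Fin n), h (σ l) = (n.factorial : ℝ) * ∑ s, h s := by
  have h1 : ∀ m : Fin n, ∑ σ : Equiv.Perm (Fin n), h (σ m) = ∑ σ : Equiv.Perm (Fin n), h (σ l) := by
    intro m
    rw [← Equiv.sum_comp (Equiv.mulRight (Equiv.swap m l))]
    simp
  have h2 : ∑ m : Fin n, ∑ σ : Equiv.Perm (Fin n), h (σ m)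
      = (n : ℝ) * ∑ σ : Equiv.Perm (Fin n), h (σ l) := by
    rw [Finset.sum_congr rfl (fun m _ => h1 m)]
    simp
  rw [← h2, Finset.sum_comm]
  have h3 : ∀ σ : Equiv.Perm (Fin n), ∑ m, h (σ m) = ∑ s, h s := fun σ => Equiv.sum_comp σ h
  rw [Finset.sum_congr rfl (fun σ _ => h3 σ)]
  simp [Fintype.card_perm]

lemma wiring_reduce (n : ℕ) (k j : Fin n → ℕ) (Q : ℕ × ℕ → ℝ) (g : Fin n → Fin n → ℝ) (l : Fin n) :
    (n : ℝ) * ∑ σ : Equiv.Perm (Fin n), ∑ τ : Equiv.Perm (Fin n),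
      g (σ l) (τ l) * wiringWeight n k j Q σ τ
    = (n.factorial : ℝ) * ∑ ρ, permW n k j Q ρ * ∑ s, g s (ρ s) := by
  have h1 : ∀ σ : Equiv.Perm (Fin n), ∑ τ : Equiv.Perm (Fin n),
      g (σ l) (τ l) * wiringWeight n k j Q σ τ
      = ∑ ρ : Equiv.Perm (Fin n), permW n k j Q ρ * g (σ l) (ρ (σ l)) := by
    intro σ
    rw [← Equiv.sum_comp (Equiv.mulRight σ)]
    refine Finset.sum_congr rfl fun ρ _ => ?_
    have : wiringWeight n k j Q σ (ρ * σ) = permW n k j Q ρ := by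
      unfold wiringWeight permW
      exact Equiv.prod_comp σ (fun s => Q (k s, j (ρ s)))
    simp [this, mul_comm]
  rw [Finset.sum_congr rfl (fun σ _ => h1 σ), Finset.sum_comm, Finset.mul_sum, Finset.mul_sum]
  refine Finset.sum_congr rfl fun ρ _ => ?_
  rw [← Finset.mul_sum, mul_left_comm, sum_perm_apply n (fun s => g s (ρ s)) l]
  ring

lemma Cnorm_reduce (n : ℕ) (k j : Fin n → ℕ) (Q : ℕ × ℕ → ℝ) :
    Cnorm n k j Q = (n.factorial : ℝ) * ∑ ρ, permW n k j Q ρ := by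
  have h1 : ∀ σ : Equiv.Perm (Fin n), ∑ τ : Equiv.Perm (Fin n), wiringWeight n k j Q σ τ
      = ∑ ρ : Equiv.Perm (Fin n), permW n k j Q ρ := by
    intro σ
    rw [← Equiv.sum_comp (Equiv.mulRight σ)]
    refine Finset.sum_congr rfl fun ρ _ => ?_
    unfold wiringWeight permW
    exact Equiv.prod_comp σ (fun s => Q (k s, j (ρ s)))
  unfold Cnorm
  rw [Finset.sum_congr rfl (fun σ _ => h1 σ)]
  simp [Fintype.card_perm]

/-- Weight of the event `ρ s = t`. -/
noncomputable def pairM (n : ℕ) (k j : Fin n → ℕ) (Q : ℕ × ℕ → ℝ) (s t : Fin n) : ℝ :=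
  ∑ ρ : Equiv.Perm (Fin n), if ρ s = t then permW n k j Q ρ else 0

lemma comp_swap {n : ℕ} (f : Fin n → ℕ) (s s' : Fin n) (h : f s = f s') (x : Fin n) :
    f (Equiv.swap s s' x) = f x := by
  rw [Equiv.swap_apply_def]; split_ifs <;> simp_all

lemma pairM_eq (n : ℕ) (k j : Fin n → ℕ) (Q : ℕ × ℕ → ℝ) (s t s' t' : Fin n)
    (hs : k s = k s') (ht : j t = j t') : pairM n k j Q s t = pairM n k j Q s' t' := by
  unfold pairM
  rw [← Equiv.sum_comp ((Equiv.mulRight (Equiv.swap s s')).trans (Equiv.mulLeft (Equiv.swap t t')))]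
  refine Finset.sum_congr rfl fun ρ _ => ?_
  have hW : permW n k j Q (Equiv.swap t t' * (ρ * Equiv.swap s s')) = permW n k j Q ρ := by
    unfold permW
    rw [← Equiv.prod_comp (Equiv.swap s s')]
    refine Finset.prod_congr rfl fun x _ => ?_
    simp [comp_swap k s s' hs, comp_swap j t t' ht]
  have he : (Equiv.swap t t' * (ρ * Equiv.swap s s')) s = t ↔ ρ s' = t' := by
    simp only [Equiv.Perm.mul_apply, Equiv.swap_apply_left]
    rw [Equiv.swap_apply_eq_iff, Equiv.swap_apply_left]
  simp only [Equiv.trans_apply, Equiv.coe_mulRight, Equiv.coe_mulLeft, hW, he]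

lemma sum_pairM (n : ℕ) (k j : Fin n → ℕ) (Q : ℕ × ℕ → ℝ) (g : Fin n → Fin n → ℝ) :
    ∑ ρ, permW n k j Q ρ * ∑ s, g s (ρ s) = ∑ s, ∑ t, g s t * pairM n k j Q s t := by
  unfold pairM
  simp only [Finset.mul_sum]
  rw [Finset.sum_comm]
  refine Finset.sum_congr rfl fun s _ => ?_
  rw [Finset.sum_comm]
  refine Finset.sum_congr rfl fun ρ _ => ?_
  simp [mul_comm]

lemma sum_pairM_const (n : ℕ) (k j : Fin n → ℕ) (Q : ℕ × ℕ → ℝ) (g : Fin n → Fin n → ℝ)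
    (k₀ j₀ : ℕ) (hg : ∀ s t, g s t ≠ 0 → k s = k₀ ∧ j t = j₀) (s₀ t₀ : Fin n)
    (hs₀ : k s₀ = k₀) (ht₀ : j t₀ = j₀) :
    ∑ ρ, permW n k j Q ρ * ∑ s, g s (ρ s) = (∑ s, ∑ t, g s t) * pairM n k j Q s₀ t₀ := by
  rw [sum_pairM, Finset.sum_mul]
  refine Finset.sum_congr rfl fun s _ => ?_
  rw [Finset.sum_mul]
  refine Finset.sum_congr rfl fun t _ => ?_
  by_cases h : g s t = 0
  · simp [h]
  · obtain ⟨h1, h2⟩ := hg s t h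
    rw [pairM_eq n k j Q s t s₀ t₀ (by rw [h1, hs₀]) (by rw [h2, ht₀])]

lemma sum_type_pairs (n : ℕ) (k j : Fin n → ℕ) (k₀ j₀ : ℕ) :
    ∑ s, ∑ t, (if k s = k₀ ∧ j t = j₀ then (1 : ℝ) else 0)
      = (stubCount n k k₀ : ℝ) * stubCount n j j₀ := by
  unfold stubCount
  rw [Finset.card_filter, Finset.card_filter]
  push_cast
  rw [Finset.sum_mul_sum]
  refine Finset.sum_congr rfl fun s _ => Finset.sum_congr rfl fun t _ => ?_
  by_cases h1 : k s = k₀ <;> by_cases h2 : j t = j₀ <;> simp [h1, h2]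

lemma sum_loop_pairs (n m : ℕ) (kd jd : Fin m → ℕ) (no ni : Fin n → Fin m)
    (hO : ∀ i, (Finset.univ.filter fun l => no l = i).card = kd i)
    (hI : ∀ i, (Finset.univ.filter fun l => ni l = i).card = jd i) (k₀ j₀ : ℕ) :
    ∑ s, ∑ t, (if no s = ni t ∧ jd (no s) = j₀ ∧ kd (no s) = k₀ then (1 : ℝ) else 0)
      = ((Finset.univ.filter fun i => jd i = j₀ ∧ kd i = k₀).card : ℝ) * ((j₀ : ℝ) * k₀) := by
  have h1 : ∀ s, ∑ t, (if no s = ni t ∧ jd (no s) = j₀ ∧ kd (no s) = k₀ then (1 : ℝ) else 0)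
      = if jd (no s) = j₀ ∧ kd (no s) = k₀ then (j₀ : ℝ) else 0 := by
    intro s
    by_cases h : jd (no s) = j₀ ∧ kd (no s) = k₀
    · simp only [h, and_self, and_true, if_true]
      rw [Finset.sum_boole]
      have := hI (no s)
      rw [h.1] at this
      rw [← this]
      simp [eq_comm]
    · simp [h]
  rw [Finset.sum_congr rfl (fun s _ => h1 s)]
  rw [← Finset.sum_fiberwise Finset.univ no]
  have h2 : ∀ i, ∑ s ∈ Finset.univ.filter (fun s => no s = i),
      (if jd (no s) = j₀ ∧ kd (no s) = k₀ then (j₀ : ℝ) else 0)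
      = if jd i = j₀ ∧ kd i = k₀ then ((j₀ : ℝ) * k₀) else 0 := by
    intro i
    rw [Finset.sum_congr rfl (g := fun _ => if jd i = j₀ ∧ kd i = k₀ then (j₀ : ℝ) else 0)]
    · rw [Finset.sum_const, hO]
      by_cases h : jd i = j₀ ∧ kd i = k₀
      · simp [h, mul_comm]
      · simp [h]
    · intro s hs
      rw [(Finset.mem_filter.mp hs).2]
  rw [Finset.sum_congr rfl (fun i _ => h2 i), ← Finset.sum_filter]
  simp

/-- Exact formula relating the self-loop weight with the mean edge-type count. -/
lemma loop_formula (n m : ℕ) (kd jd : Fin m → ℕ) (no ni : Fin n → Fin m)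
    (hO : ∀ i, (Finset.univ.filter fun l => no l = i).card = kd i)
    (hI : ∀ i, (Finset.univ.filter fun l => ni l = i).card = jd i) (k₀ j₀ : ℕ)
    (Q : ℕ × ℕ → ℝ) (l : Fin n)
    (hp : 0 < stubCount n (fun l => kd (no l)) k₀)
    (hm : 0 < stubCount n (fun l => jd (ni l)) j₀)
    (hW : 0 < ∑ ρ, permW n (fun l => kd (no l)) (fun l => jd (ni l)) Q ρ) :
    (∑ σ : Equiv.Perm (Fin n), ∑ τ : Equiv.Perm (Fin n),
      if no (σ l) = ni (τ l) ∧ jd (no (σ l)) = j₀ ∧ kd (no (σ l)) = k₀ then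
        wiringWeight n (fun l => kd (no l)) (fun l => jd (ni l)) Q σ τ else 0) /
      Cnorm n (fun l => kd (no l)) (fun l => jd (ni l)) Q
    = ((Finset.univ.filter fun i => jd i = j₀ ∧ kd i = k₀).card : ℝ) * ((j₀ : ℝ) * k₀) /
        (n * (stubCount n (fun l => kd (no l)) k₀ * stubCount n (fun l => jd (ni l)) j₀)) *
      ((∑ ρ, permW n (fun l => kd (no l)) (fun l => jd (ni l)) Q ρ *
          edgeCnt n (fun l => kd (no l)) (fun l => jd (ni l)) ρ (k₀, j₀)) /
        ∑ ρ, permW n (fun l => kd (no l)) (fun l => jd (ni l)) Q ρ) := by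
  set k : Fin n → ℕ := fun l => kd (no l) with hk
  set j : Fin n → ℕ := fun l => jd (ni l) with hj
  obtain ⟨s₀, hs₀⟩ := Finset.card_pos.mp hp
  obtain ⟨t₀, ht₀⟩ := Finset.card_pos.mp hm
  replace hs₀ := (Finset.mem_filter.mp hs₀).2
  replace ht₀ := (Finset.mem_filter.mp ht₀).2
  have hn : (0 : ℝ) < n := by exact_mod_cast l.pos
  have e1 := wiring_reduce n k j Q
    (fun s t => if no s = ni t ∧ jd (no s) = j₀ ∧ kd (no s) = k₀ then (1 : ℝ) else 0) l
  rw [sum_pairM_const n k j Q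
    (fun s t => if no s = ni t ∧ jd (no s) = j₀ ∧ kd (no s) = k₀ then (1 : ℝ) else 0)
    k₀ j₀ ?_ s₀ t₀ hs₀ ht₀, sum_loop_pairs n m kd jd no ni hO hI] at e1
  swap
  · intro s t h
    by_cases h' : no s = ni t ∧ jd (no s) = j₀ ∧ kd (no s) = k₀
    · exact ⟨h'.2.2, by rw [hj]; simp only; rw [← h'.1]; exact h'.2.1⟩
    · simp [h'] at h
  have e2 := sum_pairM_const n k j Q
    (fun s t => if k s = k₀ ∧ j t = j₀ then (1 : ℝ) else 0) k₀ j₀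
    (fun s t h => by by_contra h'; simp [h'] at h) s₀ t₀ hs₀ ht₀
  rw [sum_type_pairs] at e2
  simp only [ite_mul, one_mul, zero_mul] at e1
  rw [Cnorm_reduce]
  unfold edgeCnt
  simp only
  rw [e2]
  have hp' : (0 : ℝ) < stubCount n k k₀ := by exact_mod_cast hp
  have hm' : (0 : ℝ) < stubCount n j j₀ := by exact_mod_cast hm
  have hf : (0 : ℝ) < n.factorial := by exact_mod_cast n.factorial_pos
  have e3 := (eq_div_iff hn.ne').mpr ((mul_comm _ _).trans e1)
  rw [e3]
  field_simp

/-- Switching identity. -/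
lemma permW_swap (n : ℕ) (k j : Fin n → ℕ) (Q : ℕ × ℕ → ℝ) (ρ : Equiv.Perm (Fin n))
    (s s' : Fin n) (h : s ≠ s') :
    permW n k j Q (ρ * Equiv.swap s s') * (Q (k s, j (ρ s)) * Q (k s', j (ρ s')))
      = permW n k j Q ρ * (Q (k s, j (ρ s')) * Q (k s', j (ρ s))) := by
  unfold permW
  have hs' : s' ∈ (Finset.univ : Finset (Fin n)).erase s := by simp [h.symm]
  rw [← Finset.mul_prod_erase Finset.univ _ (Finset.mem_univ s),
    ← Finset.mul_prod_erase _ _ hs', ← Finset.mul_prod_erase Finset.univ (fun x => Q (k x, j (ρ x))) (Finset.mem_univ s),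
    ← Finset.mul_prod_erase _ (fun x => Q (k x, j (ρ x))) hs']
  have : ∏ x ∈ (Finset.univ.erase s).erase s', Q (k x, j ((ρ * Equiv.swap s s') x))
      = ∏ x ∈ (Finset.univ.erase s).erase s', Q (k x, j (ρ x)) := by
    refine Finset.prod_congr rfl fun x hx => ?_
    simp only [Finset.mem_erase] at hx
    rw [Equiv.Perm.mul_apply, Equiv.swap_apply_of_ne_of_ne hx.2.1 hx.1]
  rw [this]
  simp
  ring

lemma edgeCnt_nonneg (n : ℕ) (k j : Fin n → ℕ) (ρ : Equiv.Perm (Fin n)) (p : ℕ × ℕ) :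
    0 ≤ edgeCnt n k j ρ p := by
  unfold edgeCnt
  exact Finset.sum_nonneg fun s _ => by split_ifs <;> norm_num

lemma edgeCnt_le (n : ℕ) (k j : Fin n → ℕ) (ρ : Equiv.Perm (Fin n)) (p : ℕ × ℕ) :
    edgeCnt n k j ρ p ≤ n := by
  unfold edgeCnt
  calc _ ≤ ∑ s : Fin n, (1 : ℝ) := Finset.sum_le_sum fun s _ => by split_ifs <;> norm_num
    _ = n := by simp

lemma edgeCnt_swap (n : ℕ) (k j : Fin n → ℕ) (ρ : Equiv.Perm (Fin n)) (s s' : Fin n) (p : ℕ × ℕ) :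
    |edgeCnt n k j ρ p - edgeCnt n k j (ρ * Equiv.swap s s') p| ≤ 2 := by
  unfold edgeCnt
  rw [← Finset.sum_sub_distrib]
  refine (Finset.abs_sum_le_sum_abs _ _).trans ?_
  calc _ ≤ ∑ x : Fin n, ((if x = s then (1 : ℝ) else 0) + (if x = s' then (1 : ℝ) else 0)) := by
        refine Finset.sum_le_sum fun x _ => ?_
        by_cases h1 : x = s
        · have : (0 : ℝ) ≤ if x = s' then (1 : ℝ) else 0 := by split_ifs <;> norm_num
          refine le_trans (b := 1) ?_ (by simp [h1]; split_ifs <;> norm_num)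
          split_ifs <;> norm_num
        · by_cases h2 : x = s'
          · refine le_trans (b := 1) ?_ (by simp [h2]; split_ifs <;> norm_num)
            split_ifs <;> norm_num
          · rw [Equiv.Perm.mul_apply, Equiv.swap_apply_of_ne_of_ne h1 h2]
            simp [h1, h2]
    _ = 2 := by rw [Finset.sum_add_distrib]; simp; norm_num

/-- Cross difference of a matrix `X`. -/
noncomputable def crossD (Q X : ℕ × ℕ → ℝ) (a a' b b' : ℕ) : ℝ :=
  Q (a, b') * Q (a', b) * (X (a, b) * X (a', b')) - Q (a, b) * Q (a', b') * (X (a, b') * X (a', b))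

lemma prod_diff_bound (N x y x' y' : ℝ) (hx' : |x'| ≤ N) (hy : |y| ≤ N)
    (h1 : |x - x'| ≤ 2) (h2 : |y - y'| ≤ 2) : |x * y - x' * y'| ≤ 4 * N := by
  have : x * y - x' * y' = (x - x') * y + x' * (y - y') := by ring
  rw [this]
  refine (abs_add_le _ _).trans ?_
  rw [abs_mul, abs_mul]
  nlinarith [abs_nonneg y, abs_nonneg x', abs_nonneg (x - x'), abs_nonneg (y - y')]

lemma crossD_swap (n : ℕ) (k j : Fin n → ℕ) (Q : ℕ × ℕ → ℝ) (ρ : Equiv.Perm (Fin n)) (s s' : Fin n)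
    (a a' b b' : ℕ)
    (h1 : |Q (a, b') * Q (a', b)| ≤ 1) (h2 : |Q (a, b) * Q (a', b')| ≤ 1) :
    |crossD Q (edgeCnt n k j ρ) a a' b b' - crossD Q (edgeCnt n k j (ρ * Equiv.swap s s')) a a' b b'|
      ≤ 8 * n := by
  have habs : ∀ ρ p, |edgeCnt n k j ρ p| ≤ n := fun ρ p => by
    rw [abs_of_nonneg (edgeCnt_nonneg ..)]; exact edgeCnt_le ..
  have b1 := prod_diff_bound n (edgeCnt n k j ρ (a, b)) (edgeCnt n k j ρ (a', b'))
    (edgeCnt n k j (ρ * Equiv.swap s s') (a, b)) (edgeCnt n k j (ρ * Equiv.swap s s') (a', b'))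
    (habs _ _) (habs _ _) (edgeCnt_swap ..) (edgeCnt_swap ..)
  have b2 := prod_diff_bound n (edgeCnt n k j ρ (a, b')) (edgeCnt n k j ρ (a', b))
    (edgeCnt n k j (ρ * Equiv.swap s s') (a, b')) (edgeCnt n k j (ρ * Equiv.swap s s') (a', b))
    (habs _ _) (habs _ _) (edgeCnt_swap ..) (edgeCnt_swap ..)
  unfold crossD
  have : ∀ A B u v u' v' : ℝ, |A| ≤ 1 → |B| ≤ 1 → |u - u'| ≤ 4 * n → |v - v'| ≤ 4 * n →
      |(A * u - B * v) - (A * u' - B * v')| ≤ 8 * n := by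
    intro A B u v u' v' hA hB hu hv
    have e : (A * u - B * v) - (A * u' - B * v') = A * (u - u') - B * (v - v') := by ring
    rw [e]
    refine (abs_sub _ _).trans ?_
    rw [abs_mul, abs_mul]
    nlinarith [abs_nonneg (u - u'), abs_nonneg (v - v'), abs_nonneg A, abs_nonneg B]
  exact this _ _ _ _ _ _ h1 h2 b1 b2

/-- indicator of two stubs having types. -/
noncomputable def ind2 (n : ℕ) (k j : Fin n → ℕ) (ρ : Equiv.Perm (Fin n)) (a a' b b' : ℕ)
    (s s' : Fin n) : ℝ :=
  (if k s = a ∧ j (ρ s) = b then 1 else 0) * (if k s' = a' ∧ j (ρ s') = b' then 1 else 0)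

lemma ind2_nonneg (n : ℕ) (k j : Fin n → ℕ) (ρ : Equiv.Perm (Fin n)) (a a' b b' : ℕ)
    (s s' : Fin n) : 0 ≤ ind2 n k j ρ a a' b b' s s' := by
  unfold ind2; split_ifs <;> norm_num

lemma ind2_le (n : ℕ) (k j : Fin n → ℕ) (ρ : Equiv.Perm (Fin n)) (a a' b b' : ℕ)
    (s s' : Fin n) : ind2 n k j ρ a a' b b' s s' ≤ 1 := by
  unfold ind2; split_ifs <;> norm_num

lemma switch_pt (n : ℕ) (k j : Fin n → ℕ) (Q : ℕ × ℕ → ℝ) (ρ : Equiv.Perm (Fin n))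
    (a a' b b' : ℕ) (haa : a ≠ a') (s s' : Fin n) :
    permW n k j Q (ρ * Equiv.swap s s') * (Q (a, b) * Q (a', b') *
        ind2 n k j (ρ * Equiv.swap s s') a a' b' b s s')
      = permW n k j Q ρ * (Q (a, b') * Q (a', b) * ind2 n k j ρ a a' b b' s s') := by
  unfold ind2
  simp only [Equiv.Perm.mul_apply, Equiv.swap_apply_left, Equiv.swap_apply_right]
  by_cases h1 : k s = a ∧ j (ρ s) = b
  · by_cases h2 : k s' = a' ∧ j (ρ s') = b'
    · have hne : s ≠ s' := by
        rintro rfl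
        exact haa (h1.1.symm.trans h2.1)
      have := permW_swap n k j Q ρ s s' hne
      rw [h1.1, h1.2, h2.1, h2.2] at this
      simp only [h1, h2, and_self, if_true, mul_one]
      exact this
    · have h2' : ¬ ((k s = a ∧ j (ρ s') = b') ∧ (k s' = a' ∧ j (ρ s) = b)) := by tauto
      simp only [h2, if_false, mul_zero]
      by_cases h3 : (k s = a ∧ j (ρ s') = b')
      · have : ¬ (k s' = a' ∧ j (ρ s) = b) := fun h => h2' ⟨h3, h⟩
        simp [this]
      · simp [h3]
  · have h2' : ¬ ((k s = a ∧ j (ρ s') = b') ∧ (k s' = a' ∧ j (ρ s) = b)) := by tauto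
    simp only [h1, if_false, zero_mul, mul_zero]
    by_cases h3 : (k s = a ∧ j (ρ s') = b')
    · have : ¬ (k s' = a' ∧ j (ρ s) = b) := fun h => h2' ⟨h3, h⟩
      simp [this]
    · simp [h3]

lemma permW_nonneg (n : ℕ) (k j : Fin n → ℕ) (Q : ℕ × ℕ → ℝ) (hQ0 : ∀ p, 0 ≤ Q p)
    (ρ : Equiv.Perm (Fin n)) : 0 ≤ permW n k j Q ρ :=
  Finset.prod_nonneg fun _ _ => hQ0 _

/-- Second moment bound for cross differences. -/
lemma crossD_sq (n : ℕ) (k j : Fin n → ℕ) (Q : ℕ × ℕ → ℝ) (hQ0 : ∀ p, 0 ≤ Q p)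
    (a a' b b' : ℕ)
    (h1 : |Q (a, b') * Q (a', b)| ≤ 1) (h2 : |Q (a, b) * Q (a', b')| ≤ 1) :
    ∑ ρ, permW n k j Q ρ * crossD Q (edgeCnt n k j ρ) a a' b b' ^ 2
      ≤ 8 * (n : ℝ) ^ 3 * ∑ ρ, permW n k j Q ρ := by
  have hWs : 0 ≤ ∑ ρ, permW n k j Q ρ := Finset.sum_nonneg fun ρ _ => permW_nonneg n k j Q hQ0 ρ
  by_cases haa : a = a'
  · subst haa
    have : ∀ X : ℕ × ℕ → ℝ, crossD Q X a a b b' = 0 := by intro X; unfold crossD; ring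
    simp only [this]
    simp
    positivity
  set D : Equiv.Perm (Fin n) → ℝ := fun ρ => crossD Q (edgeCnt n k j ρ) a a' b b' with hD
  have hexp : ∀ ρ, D ρ = ∑ s, ∑ s', (Q (a, b') * Q (a', b) * ind2 n k j ρ a a' b b' s s'
      - Q (a, b) * Q (a', b') * ind2 n k j ρ a a' b' b s s') := by
    intro ρ
    simp only [hD, crossD, edgeCnt, Finset.sum_sub_distrib, ← Finset.mul_sum, ind2,
      Finset.sum_mul_sum]
  have key : ∀ s s', ∑ ρ, permW n k j Q ρ * ((Q (a, b') * Q (a', b) * ind2 n k j ρ a a' b b' s s'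
      - Q (a, b) * Q (a', b') * ind2 n k j ρ a a' b' b s s') * D ρ)
      ≤ 8 * n * ∑ ρ, permW n k j Q ρ := by
    intro s s'
    have e1 : ∑ ρ, permW n k j Q ρ * (Q (a, b) * Q (a', b') * ind2 n k j ρ a a' b' b s s') * D ρ
        = ∑ ρ, permW n k j Q ρ * (Q (a, b') * Q (a', b) * ind2 n k j ρ a a' b b' s s') *
          D (ρ * Equiv.swap s s') := by
      rw [← Equiv.sum_comp (Equiv.mulRight (Equiv.swap s s'))]
      refine Finset.sum_congr rfl fun ρ _ => ?_
      simp only [Equiv.coe_mulRight]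
      rw [switch_pt n k j Q ρ a a' b b' haa s s']
    have e2 : ∑ ρ, permW n k j Q ρ * ((Q (a, b') * Q (a', b) * ind2 n k j ρ a a' b b' s s'
      - Q (a, b) * Q (a', b') * ind2 n k j ρ a a' b' b s s') * D ρ)
      = ∑ ρ, permW n k j Q ρ * (Q (a, b') * Q (a', b) * ind2 n k j ρ a a' b b' s s') *
          (D ρ - D (ρ * Equiv.swap s s')) := by
      simp only [mul_sub, Finset.sum_sub_distrib]
      rw [← e1, ← Finset.sum_sub_distrib]
      refine Finset.sum_congr rfl fun ρ _ => ?_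
      ring
    rw [e2, Finset.mul_sum]
    refine Finset.sum_le_sum fun ρ _ => ?_
    have hd := crossD_swap n k j Q ρ s s' a a' b b' h1 h2
    have hd' : D ρ - D (ρ * Equiv.swap s s') ≤ 8 * n := (le_abs_self _).trans hd
    have hc0 : 0 ≤ Q (a, b') * Q (a', b) * ind2 n k j ρ a a' b b' s s' :=
      mul_nonneg (mul_nonneg (hQ0 _) (hQ0 _)) (ind2_nonneg ..)
    have hc1 : Q (a, b') * Q (a', b) * ind2 n k j ρ a a' b b' s s' ≤ 1 :=
      mul_le_one₀ ((le_abs_self _).trans h1) (ind2_nonneg ..) (ind2_le ..)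
    have hw := permW_nonneg n k j Q hQ0 ρ
    have hn0 : (0 : ℝ) ≤ 8 * n := by positivity
    calc _ ≤ permW n k j Q ρ * (Q (a, b') * Q (a', b) * ind2 n k j ρ a a' b b' s s') * (8 * n) :=
          mul_le_mul_of_nonneg_left hd' (mul_nonneg hw hc0)
      _ ≤ permW n k j Q ρ * 1 * (8 * n) := by gcongr
      _ = _ := by ring
  calc ∑ ρ, permW n k j Q ρ * D ρ ^ 2
      = ∑ s, ∑ s', ∑ ρ, permW n k j Q ρ * ((Q (a, b') * Q (a', b) * ind2 n k j ρ a a' b b' s s'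
      - Q (a, b) * Q (a', b') * ind2 n k j ρ a a' b' b s s') * D ρ) := by
        have : ∀ s, ∑ s', ∑ ρ, permW n k j Q ρ * ((Q (a, b') * Q (a', b) * ind2 n k j ρ a a' b b' s s'
      - Q (a, b) * Q (a', b') * ind2 n k j ρ a a' b' b s s') * D ρ) =
         ∑ ρ, ∑ s', permW n k j Q ρ * ((Q (a, b') * Q (a', b) * ind2 n k j ρ a a' b b' s s'
      - Q (a, b) * Q (a', b') * ind2 n k j ρ a a' b' b s s') * D ρ) := fun s => Finset.sum_comm
        rw [Finset.sum_congr rfl (fun s _ => this s), Finset.sum_comm]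
        refine Finset.sum_congr rfl fun ρ _ => ?_
        simp only [← Finset.mul_sum, ← Finset.sum_mul]
        rw [← hexp, sq]
    _ ≤ ∑ s : Fin n, ∑ s' : Fin n, 8 * n * ∑ ρ, permW n k j Q ρ :=
        Finset.sum_le_sum fun s _ => Finset.sum_le_sum fun s' _ => key s s'
    _ = _ := by simp; ring

/-- Uniqueness of the matrix with given margins and cross ratios. -/
lemma unique_matrix (K : ℕ) (hK : 1 ≤ K) (Q X : ℕ × ℕ → ℝ)
    (hQpos : ∀ k' ∈ Finset.Icc 1 K, ∀ j' ∈ Finset.Icc 1 K, 0 < Q (k', j'))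
    (hX : ∀ p, 0 ≤ X p)
    (hr : ∀ k' ∈ Finset.Icc 1 K, ∑ j' ∈ Finset.Icc 1 K, X (k', j') = ∑ j' ∈ Finset.Icc 1 K, Q (k', j'))
    (hc : ∀ j' ∈ Finset.Icc 1 K, ∑ k' ∈ Finset.Icc 1 K, X (k', j') = ∑ k' ∈ Finset.Icc 1 K, Q (k', j'))
    (hx : ∀ a ∈ Finset.Icc 1 K, ∀ a' ∈ Finset.Icc 1 K, ∀ b ∈ Finset.Icc 1 K, ∀ b' ∈ Finset.Icc 1 K,
      crossD Q X a a' b b' = 0) :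
    ∀ k' ∈ Finset.Icc 1 K, ∀ j' ∈ Finset.Icc 1 K, X (k', j') = Q (k', j') := by
  have h1mem : 1 ∈ Finset.Icc 1 K := Finset.mem_Icc.mpr ⟨le_rfl, hK⟩
  have hne : (Finset.Icc 1 K).Nonempty := ⟨1, h1mem⟩
  have hpos : ∀ k' ∈ Finset.Icc 1 K, ∀ j' ∈ Finset.Icc 1 K, 0 < X (k', j') := by
    intro a ha b hb
    refine lt_of_le_of_ne (hX _) fun h0 => ?_
    have hz : (∑ b' ∈ Finset.Icc 1 K, X (a, b')) * (∑ a' ∈ Finset.Icc 1 K, X (a', b)) = 0 := by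
      rw [Finset.sum_mul_sum]
      refine Finset.sum_eq_zero fun b' hb' => Finset.sum_eq_zero fun a' ha' => ?_
      have := hx a ha a' ha' b hb b' hb'
      unfold crossD at this
      rw [← h0] at this
      simp only [zero_mul, mul_zero, zero_sub, neg_eq_zero] at this
      exact (mul_eq_zero.mp this).resolve_left
        (mul_pos (hQpos a ha b hb) (hQpos a' ha' b' hb')).ne'
    rw [hr a ha, hc b hb] at hz
    have p1 : 0 < ∑ j' ∈ Finset.Icc 1 K, Q (a, j') := Finset.sum_pos (hQpos a ha) hne
    have p2 : 0 < ∑ k' ∈ Finset.Icc 1 K, Q (k', b) :=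
      Finset.sum_pos (fun k' hk' => hQpos k' hk' b hb) hne
    exact (mul_pos p1 p2).ne' hz
  set L : ℕ → ℕ → ℝ := fun a b => Real.log (X (a, b)) - Real.log (Q (a, b)) with hL
  have hLadd : ∀ a ∈ Finset.Icc 1 K, ∀ b ∈ Finset.Icc 1 K, L a b = L a 1 + (L 1 b - L 1 1) := by
    intro a ha b hb
    have h := hx a ha 1 h1mem b hb 1 h1mem
    unfold crossD at h
    have h' := congrArg Real.log (sub_eq_zero.mp h)
    have q1 := (hQpos a ha 1 h1mem).ne'
    have q2 := (hQpos 1 h1mem b hb).ne'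
    have q3 := (hQpos a ha b hb).ne'
    have q4 := (hQpos 1 h1mem 1 h1mem).ne'
    have x1 := (hpos a ha 1 h1mem).ne'
    have x2 := (hpos 1 h1mem b hb).ne'
    have x3 := (hpos a ha b hb).ne'
    have x4 := (hpos 1 h1mem 1 h1mem).ne'
    rw [Real.log_mul (mul_ne_zero q1 q2) (mul_ne_zero x3 x4), Real.log_mul q1 q2, Real.log_mul x3 x4,
      Real.log_mul (mul_ne_zero q3 q4) (mul_ne_zero x1 x2), Real.log_mul q3 q4, Real.log_mul x1 x2] at h'
    simp only [hL]
    linarith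
  have hsum : ∑ a ∈ Finset.Icc 1 K, ∑ b ∈ Finset.Icc 1 K, (X (a, b) - Q (a, b)) * L a b = 0 := by
    have e : ∑ a ∈ Finset.Icc 1 K, ∑ b ∈ Finset.Icc 1 K, (X (a, b) - Q (a, b)) * L a b
        = ∑ a ∈ Finset.Icc 1 K, ∑ b ∈ Finset.Icc 1 K, (X (a, b) - Q (a, b)) * L a 1
        + ∑ b ∈ Finset.Icc 1 K, ∑ a ∈ Finset.Icc 1 K, (X (a, b) - Q (a, b)) * (L 1 b - L 1 1) := by
      rw [Finset.sum_comm (s := Finset.Icc 1 K) (t := Finset.Icc 1 K)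
        (f := fun b a => (X (a, b) - Q (a, b)) * (L 1 b - L 1 1)), ← Finset.sum_add_distrib]
      refine Finset.sum_congr rfl fun a ha => ?_
      rw [← Finset.sum_add_distrib]
      refine Finset.sum_congr rfl fun b hb => ?_
      rw [hLadd a ha b hb]; ring
    rw [e, Finset.sum_eq_zero, Finset.sum_eq_zero, add_zero]
    · intro b hb
      rw [← Finset.sum_mul, Finset.sum_sub_distrib, hc b hb, sub_self, zero_mul]
    · intro a ha
      rw [← Finset.sum_mul, Finset.sum_sub_distrib, hr a ha, sub_self, zero_mul]
  have hnn : ∀ a ∈ Finset.Icc 1 K, ∀ b ∈ Finset.Icc 1 K, 0 ≤ (X (a, b) - Q (a, b)) * L a b := by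
    intro a ha b hb
    rcases le_total (X (a, b)) (Q (a, b)) with h | h
    · exact mul_nonneg_of_nonpos_of_nonpos (sub_nonpos.mpr h)
        (sub_nonpos.mpr (Real.log_le_log (hpos a ha b hb) h))
    · exact mul_nonneg (sub_nonneg.mpr h) (sub_nonneg.mpr (Real.log_le_log (hQpos a ha b hb) h))
  intro a ha b hb
  have h1 := (Finset.sum_eq_zero_iff_of_nonneg
    (fun a ha => Finset.sum_nonneg (hnn a ha))).mp hsum a ha
  have h2 := (Finset.sum_eq_zero_iff_of_nonneg (hnn a ha)).mp h1 b hb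
  rcases mul_eq_zero.mp h2 with h | h
  · exact sub_eq_zero.mp h
  · exact Real.log_injOn_pos (hpos a ha b hb) (hQpos a ha b hb) (sub_eq_zero.mp h)

/-- The defect functional. -/
noncomputable def defect (K : ℕ) (Q X : ℕ × ℕ → ℝ) : ℝ :=
  (∑ a ∈ Finset.Icc 1 K, ∑ a' ∈ Finset.Icc 1 K, ∑ b ∈ Finset.Icc 1 K, ∑ b' ∈ Finset.Icc 1 K,
    crossD Q X a a' b b' ^ 2)
  + ((∑ a ∈ Finset.Icc 1 K, |∑ b ∈ Finset.Icc 1 K, X (a, b) - ∑ b ∈ Finset.Icc 1 K, Q (a, b)|)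
  + ∑ b ∈ Finset.Icc 1 K, |∑ a ∈ Finset.Icc 1 K, X (a, b) - ∑ a ∈ Finset.Icc 1 K, Q (a, b)|)

lemma defect_nonneg (K : ℕ) (Q X : ℕ × ℕ → ℝ) : 0 ≤ defect K Q X := by
  unfold defect; positivity

lemma defect_zero (K : ℕ) (hK : 1 ≤ K) (Q X : ℕ × ℕ → ℝ)
    (hQpos : ∀ k' ∈ Finset.Icc 1 K, ∀ j' ∈ Finset.Icc 1 K, 0 < Q (k', j'))
    (hX : ∀ p, 0 ≤ X p) (h : defect K Q X = 0) :
    ∀ k' ∈ Finset.Icc 1 K, ∀ j' ∈ Finset.Icc 1 K, X (k', j') = Q (k', j') := by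
  unfold defect at h
  rw [add_eq_zero_iff_of_nonneg (by positivity) (by positivity),
    add_eq_zero_iff_of_nonneg (by positivity) (by positivity)] at h
  obtain ⟨h1, h2, h3⟩ := h
  apply unique_matrix K hK Q X hQpos hX
  · intro a ha
    have := (Finset.sum_eq_zero_iff_of_nonneg (fun _ _ => abs_nonneg _)).mp h2 a ha
    exact sub_eq_zero.mp (abs_eq_zero.mp this)
  · intro a ha
    have := (Finset.sum_eq_zero_iff_of_nonneg (fun _ _ => abs_nonneg _)).mp h3 a ha
    exact sub_eq_zero.mp (abs_eq_zero.mp this)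
  · intro a ha a' ha' b hb b' hb'
    have n3 : ∀ x y w, 0 ≤ ∑ b' ∈ Finset.Icc 1 K, crossD Q X x y w b' ^ 2 :=
      fun x y w => Finset.sum_nonneg fun _ _ => sq_nonneg _
    have n2 : ∀ x y, 0 ≤ ∑ b ∈ Finset.Icc 1 K, ∑ b' ∈ Finset.Icc 1 K, crossD Q X x y b b' ^ 2 :=
      fun x y => Finset.sum_nonneg fun _ _ => n3 _ _ _
    have n1 : ∀ x, 0 ≤ ∑ a' ∈ Finset.Icc 1 K, ∑ b ∈ Finset.Icc 1 K, ∑ b' ∈ Finset.Icc 1 K,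
        crossD Q X x a' b b' ^ 2 := fun x => Finset.sum_nonneg fun _ _ => n2 _ _
    have g1 := (Finset.sum_eq_zero_iff_of_nonneg (fun x _ => n1 x)).mp h1 a ha
    have g2 := (Finset.sum_eq_zero_iff_of_nonneg (fun x _ => n2 a x)).mp g1 a' ha'
    have g3 := (Finset.sum_eq_zero_iff_of_nonneg (fun x _ => n3 a a' x)).mp g2 b hb
    have g4 := (Finset.sum_eq_zero_iff_of_nonneg (fun x _ => sq_nonneg _)).mp g3 b' hb'
    exact pow_eq_zero_iff two_ne_zero |>.mp g4

/-- Stability by compactness. -/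
lemma stability (K : ℕ) (hK : 1 ≤ K) (Q : ℕ × ℕ → ℝ)
    (hQpos : ∀ k' ∈ Finset.Icc 1 K, ∀ j' ∈ Finset.Icc 1 K, 0 < Q (k', j'))
    (k₀ j₀ : ℕ) (hk₀ : k₀ ∈ Finset.Icc 1 K) (hj₀ : j₀ ∈ Finset.Icc 1 K) (ε : ℝ) (hε : 0 < ε) :
    ∃ M : ℝ, 0 ≤ M ∧ ∀ X : ℕ × ℕ → ℝ, (∀ p, 0 ≤ X p ∧ X p ≤ 1) →
      |X (k₀, j₀) - Q (k₀, j₀)| ≤ ε + M * defect K Q X := by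
  set S : Set (ℕ × ℕ → ℝ) := (Set.univ.pi fun _ => Set.Icc 0 1) ∩
    {X | ε ≤ |X (k₀, j₀) - Q (k₀, j₀)|} with hS
  have hScomp : IsCompact S := by
    refine (isCompact_univ_pi fun _ => isCompact_Icc).inter_right ?_
    exact isClosed_le continuous_const (by fun_prop)
  have hcont : Continuous (defect K Q) := by
    unfold defect crossD
    fun_prop
  have hmem : ∀ X : ℕ × ℕ → ℝ, (∀ p, 0 ≤ X p ∧ X p ≤ 1) → ε < |X (k₀, j₀) - Q (k₀, j₀)| → X ∈ S :=
    fun X hX h => ⟨fun p _ => hX p, h.le⟩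
  by_cases hne : S.Nonempty
  · obtain ⟨Y, hY, hmin⟩ := hScomp.exists_isMinOn hne hcont.continuousOn
    have hYpos : 0 < defect K Q Y := by
      refine lt_of_le_of_ne (defect_nonneg ..) fun h => ?_
      have := defect_zero K hK Q Y hQpos (fun p => (hY.1 p trivial).1) h.symm k₀ hk₀ j₀ hj₀
      have h2 := hY.2
      simp only [Set.mem_ofPred_eq, this, sub_self, abs_zero] at h2
      linarith
    refine ⟨(1 + |Q (k₀, j₀)|) / defect K Q Y, by positivity, fun X hX => ?_⟩
    by_cases h : ε < |X (k₀, j₀) - Q (k₀, j₀)|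
    · have hm : defect K Q Y ≤ defect K Q X := hmin (hmem X hX h)
      have : |X (k₀, j₀) - Q (k₀, j₀)| ≤ 1 + |Q (k₀, j₀)| := by
        refine (abs_sub _ _).trans ?_
        gcongr
        rw [abs_of_nonneg (hX _).1]; exact (hX _).2
      have h3 : 1 + |Q (k₀, j₀)| ≤ (1 + |Q (k₀, j₀)|) / defect K Q Y * defect K Q X := by
        rw [div_mul_eq_mul_div, le_div_iff₀ hYpos]
        gcongr
      linarith
    · have : 0 ≤ (1 + |Q (k₀, j₀)|) / defect K Q Y * defect K Q X :=
        mul_nonneg (by positivity) (defect_nonneg ..)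
      linarith
  · refine ⟨0, le_rfl, fun X hX => ?_⟩
    by_contra h
    exact hne ⟨X, hmem X hX (by linarith)⟩

lemma row_sum (n K : ℕ) (k j : Fin n → ℕ) (hj : ∀ s, j s ∈ Finset.Icc 1 K)
    (ρ : Equiv.Perm (Fin n)) (a : ℕ) :
    ∑ b ∈ Finset.Icc 1 K, edgeCnt n k j ρ (a, b) = stubCount n k a := by
  unfold edgeCnt stubCount
  rw [Finset.sum_comm, Finset.card_filter]
  push_cast
  refine Finset.sum_congr rfl fun s _ => ?_
  by_cases h : k s = a
  · simp only [h, true_and, if_true]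
    rw [Finset.sum_ite_eq]
    simp [hj (ρ s)]
  · simp [h]

lemma col_sum (n K : ℕ) (k j : Fin n → ℕ) (hk : ∀ s, k s ∈ Finset.Icc 1 K)
    (ρ : Equiv.Perm (Fin n)) (b : ℕ) :
    ∑ a ∈ Finset.Icc 1 K, edgeCnt n k j ρ (a, b) = stubCount n j b := by
  unfold edgeCnt stubCount
  rw [Finset.sum_comm, Finset.card_filter, ← Equiv.sum_comp ρ (fun s => if j s = b then 1 else 0)]
  push_cast
  refine Finset.sum_congr rfl fun s _ => ?_
  by_cases h : j (ρ s) = b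
  · simp only [h, and_true, if_true]
    rw [Finset.sum_ite_eq]
    simp [hk s]
  · simp [h]

/-- Weighted mean of the defect. -/
lemma mean_defect (n K : ℕ) (hn : 0 < n) (k j : Fin n → ℕ) (Q : ℕ × ℕ → ℝ) (hQ0 : ∀ p, 0 ≤ Q p)
    (hQ1 : ∀ k' ∈ Finset.Icc 1 K, ∀ j' ∈ Finset.Icc 1 K, Q (k', j') ≤ 1)
    (hk : ∀ s, k s ∈ Finset.Icc 1 K) (hj : ∀ s, j s ∈ Finset.Icc 1 K) :
    ∑ ρ, permW n k j Q ρ * defect K Q (fun p => edgeCnt n k j ρ p / n)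
      ≤ ((K : ℝ) ^ 4 * (8 / n) +
        ((∑ a ∈ Finset.Icc 1 K, |(stubCount n k a : ℝ) / n - ∑ b ∈ Finset.Icc 1 K, Q (a, b)|)
        + ∑ b ∈ Finset.Icc 1 K, |(stubCount n j b : ℝ) / n - ∑ a ∈ Finset.Icc 1 K, Q (a, b)|))
        * ∑ ρ, permW n k j Q ρ := by
  have hn' : (0 : ℝ) < n := by exact_mod_cast hn
  unfold defect
  simp only [← Finset.sum_div, row_sum n K k j hj, col_sum n K k j hk]
  simp only [mul_add (permW _ _ _ _ _), Finset.sum_add_distrib]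
  rw [add_mul, add_mul, Finset.mul_sum (f := permW n k j Q), Finset.mul_sum (f := permW n k j Q),
    Finset.mul_sum (f := permW n k j Q)]
  gcongr ?_ + (?_ + ?_)
  · have hterm : ∀ a ∈ Finset.Icc 1 K, ∀ a' ∈ Finset.Icc 1 K, ∀ b ∈ Finset.Icc 1 K,
        ∀ b' ∈ Finset.Icc 1 K,
        ∑ ρ, permW n k j Q ρ * crossD Q (fun p => edgeCnt n k j ρ p / n) a a' b b' ^ 2
          ≤ 8 / n * ∑ ρ, permW n k j Q ρ := by
      intro a ha a' ha' b hb b' hb'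
      have hq : ∀ x ∈ Finset.Icc 1 K, ∀ y ∈ Finset.Icc 1 K, ∀ x' ∈ Finset.Icc 1 K,
          ∀ y' ∈ Finset.Icc 1 K, |Q (x, y) * Q (x', y')| ≤ 1 := by
        intro x hx y hy x' hx' y' hy'
        rw [abs_of_nonneg (mul_nonneg (hQ0 _) (hQ0 _))]
        exact mul_le_one₀ (hQ1 x hx y hy) (hQ0 _) (hQ1 x' hx' y' hy')
      have h := crossD_sq n k j Q hQ0 a a' b b' (hq a ha b' hb' a' ha' b hb)
        (hq a ha b hb a' ha' b' hb')
      have e : ∀ ρ, crossD Q (fun p => edgeCnt n k j ρ p / n) a a' b b'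
          = crossD Q (edgeCnt n k j ρ) a a' b b' / n ^ 2 := by
        intro ρ; unfold crossD; field_simp
      have e2 : ∑ ρ, permW n k j Q ρ * crossD Q (fun p => edgeCnt n k j ρ p / n) a a' b b' ^ 2
          = (∑ ρ, permW n k j Q ρ * crossD Q (edgeCnt n k j ρ) a a' b b' ^ 2) / n ^ 4 := by
        rw [Finset.sum_div]
        refine Finset.sum_congr rfl fun ρ _ => ?_
        rw [e]; field_simp
      rw [e2, div_le_iff₀ (by positivity)]
      refine h.trans (le_of_eq ?_)
      field_simp
    have hsw : ∑ ρ, permW n k j Q ρ * (∑ a ∈ Finset.Icc 1 K, ∑ a' ∈ Finset.Icc 1 K,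
        ∑ b ∈ Finset.Icc 1 K, ∑ b' ∈ Finset.Icc 1 K,
          crossD Q (fun p => edgeCnt n k j ρ p / n) a a' b b' ^ 2)
        = ∑ a ∈ Finset.Icc 1 K, ∑ a' ∈ Finset.Icc 1 K,
        ∑ b ∈ Finset.Icc 1 K, ∑ b' ∈ Finset.Icc 1 K,
          ∑ ρ, permW n k j Q ρ * crossD Q (fun p => edgeCnt n k j ρ p / n) a a' b b' ^ 2 := by
      simp only [Finset.mul_sum]
      rw [Finset.sum_comm]; refine Finset.sum_congr rfl fun a _ => ?_
      rw [Finset.sum_comm]; refine Finset.sum_congr rfl fun a' _ => ?_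
      rw [Finset.sum_comm]; refine Finset.sum_congr rfl fun b _ => ?_
      rw [Finset.sum_comm]
    rw [← Finset.mul_sum, hsw]
    calc _ ≤ ∑ a ∈ Finset.Icc 1 K, ∑ a' ∈ Finset.Icc 1 K,
        ∑ b ∈ Finset.Icc 1 K, ∑ b' ∈ Finset.Icc 1 K, 8 / n * ∑ ρ, permW n k j Q ρ :=
          Finset.sum_le_sum fun a ha => Finset.sum_le_sum fun a' ha' =>
            Finset.sum_le_sum fun b hb => Finset.sum_le_sum fun b' hb' => hterm a ha a' ha' b hb b' hb'
      _ = _ := by simp; ring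
  · rw [← Finset.sum_mul, ← Finset.mul_sum, mul_comm]
  · rw [← Finset.sum_mul, ← Finset.mul_sum, mul_comm]

lemma mean_close (n K : ℕ) (hn : 0 < n) (k j : Fin n → ℕ) (Q : ℕ × ℕ → ℝ) (hQ0 : ∀ p, 0 ≤ Q p)
    (hQ1 : ∀ k' ∈ Finset.Icc 1 K, ∀ j' ∈ Finset.Icc 1 K, Q (k', j') ≤ 1)
    (hk : ∀ s, k s ∈ Finset.Icc 1 K) (hj : ∀ s, j s ∈ Finset.Icc 1 K)
    (hW : 0 < ∑ ρ, permW n k j Q ρ) (k₀ j₀ : ℕ) (ε M : ℝ) (hM : 0 ≤ M)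
    (hst : ∀ X : ℕ × ℕ → ℝ, (∀ p, 0 ≤ X p ∧ X p ≤ 1) →
      |X (k₀, j₀) - Q (k₀, j₀)| ≤ ε + M * defect K Q X) :
    |(∑ ρ, permW n k j Q ρ * edgeCnt n k j ρ (k₀, j₀)) / (∑ ρ, permW n k j Q ρ) / n - Q (k₀, j₀)|
      ≤ ε + M * ((K : ℝ) ^ 4 * (8 / n) +
        ((∑ a ∈ Finset.Icc 1 K, |(stubCount n k a : ℝ) / n - ∑ b ∈ Finset.Icc 1 K, Q (a, b)|)
        + ∑ b ∈ Finset.Icc 1 K, |(stubCount n j b : ℝ) / n - ∑ a ∈ Finset.Icc 1 K, Q (a, b)|)) := by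
  have hn' : (0 : ℝ) < n := by exact_mod_cast hn
  have hmd := mean_defect n K hn k j Q hQ0 hQ1 hk hj
  set B := ((K : ℝ) ^ 4 * (8 / n) +
        ((∑ a ∈ Finset.Icc 1 K, |(stubCount n k a : ℝ) / n - ∑ b ∈ Finset.Icc 1 K, Q (a, b)|)
        + ∑ b ∈ Finset.Icc 1 K, |(stubCount n j b : ℝ) / n - ∑ a ∈ Finset.Icc 1 K, Q (a, b)|))
  have e : (∑ ρ, permW n k j Q ρ * edgeCnt n k j ρ (k₀, j₀)) / (∑ ρ, permW n k j Q ρ) / n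
      - Q (k₀, j₀) = (∑ ρ, permW n k j Q ρ * (edgeCnt n k j ρ (k₀, j₀) / n - Q (k₀, j₀))) /
        (∑ ρ, permW n k j Q ρ) := by
    simp only [mul_sub, Finset.sum_sub_distrib, ← Finset.sum_mul, ← mul_div_assoc, ← Finset.sum_div]
    field_simp
  rw [e, abs_div, abs_of_pos hW, div_le_iff₀ hW]
  refine (Finset.abs_sum_le_sum_abs _ _).trans ?_
  calc _ ≤ ∑ ρ, permW n k j Q ρ * (ε + M * defect K Q (fun p => edgeCnt n k j ρ p / n)) := by
        refine Finset.sum_le_sum fun ρ _ => ?_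
        have hw := permW_nonneg n k j Q hQ0 ρ
        rw [abs_mul, abs_of_nonneg hw]
        refine mul_le_mul_of_nonneg_left (hst (fun p => edgeCnt n k j ρ p / n) fun p => ?_) hw
        exact ⟨div_nonneg (edgeCnt_nonneg ..) hn'.le,
          (div_le_one hn').mpr (edgeCnt_le ..)⟩
    _ = ε * (∑ ρ, permW n k j Q ρ)
        + M * ∑ ρ, permW n k j Q ρ * defect K Q (fun p => edgeCnt n k j ρ p / n) := by
        rw [Finset.mul_sum, Finset.mul_sum, ← Finset.sum_add_distrib]
        refine Finset.sum_congr rfl fun ρ _ => ?_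
        ring
    _ ≤ ε * (∑ ρ, permW n k j Q ρ) + M * (B * ∑ ρ, permW n k j Q ρ) := by gcongr
    _ = _ := by ring

/-- Along a sequence of node-type systems (with `N+1` nodes) whose empirical
node-type distribution converges to `P`, with `E/N → z` and empirical stub margins converging
to the marginals `(Q⁻, Q⁺)` of `Q`, `N` times the probability that a fixed edge is a self-loop
at a node of type `(j₀,k₀)` converges to `j₀ k₀ P_{j₀k₀} Q(k₀,j₀) / (z² Q⁺_{k₀} Q⁻_{j₀})`. -/
theorem stmt19 (K : ℕ) (hK : 1 ≤ K) (Q : ℕ × ℕ → ℝ) (hQ0 : ∀ p, 0 ≤ Q p)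
    (hQpos : ∀ k' j', 1 ≤ k' → k' ≤ K → 1 ≤ j' → j' ≤ K → 0 < Q (k', j'))
    (hQsum : ∑ j' ∈ Finset.Icc 1 K, ∑ k' ∈ Finset.Icc 1 K, Q (k', j') = 1)
    (P : ℕ × ℕ → ℝ) (hP : ∀ p, 0 ≤ P p)
    (hPsum : ∑ j' ∈ Finset.range (K + 1), ∑ k' ∈ Finset.range (K + 1), P (j', k') = 1)
    (z : ℝ) (hzpos : 0 < z)
    (hzk : z = ∑ k' ∈ Finset.range (K + 1),
      (k' : ℝ) * ∑ j' ∈ Finset.range (K + 1), P (j', k'))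
    (hzj : z = ∑ j' ∈ Finset.range (K + 1),
      (j' : ℝ) * ∑ k' ∈ Finset.range (K + 1), P (j', k'))
    (E : ℕ → ℕ) (hE : ∀ N, 1 ≤ E N)
    (jdeg kdeg : (N : ℕ) → Fin (N + 1) → ℕ)
    (hdeg : ∀ N i, jdeg N i ≤ K ∧ kdeg N i ≤ K)
    (nodeOut nodeIn : (N : ℕ) → Fin (E N) → Fin (N + 1))
    (hOut : ∀ N i, (Finset.univ.filter fun ℓ => nodeOut N ℓ = i).card = kdeg N i)
    (hIn : ∀ N i, (Finset.univ.filter fun ℓ => nodeIn N ℓ = i).card = jdeg N i)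
    (hu : ∀ j' k', j' ≤ K → k' ≤ K →
      Filter.Tendsto (fun N : ℕ =>
          ((Finset.univ.filter fun i : Fin (N + 1) =>
            jdeg N i = j' ∧ kdeg N i = k').card : ℝ) / (N + 1))
        Filter.atTop (nhds (P (j', k'))))
    (hEz : Filter.Tendsto (fun N : ℕ => (E N : ℝ) / (N + 1)) Filter.atTop (nhds z))
    (heminus : ∀ j', 1 ≤ j' → j' ≤ K →
      Filter.Tendsto (fun N : ℕ =>
          (stubCount (E N) (fun ℓ => jdeg N (nodeIn N ℓ)) j' : ℝ) / (E N))
        Filter.atTop (nhds (∑ k' ∈ Finset.Icc 1 K, Q (k', j'))))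
    (heplus : ∀ k', 1 ≤ k' → k' ≤ K →
      Filter.Tendsto (fun N : ℕ =>
          (stubCount (E N) (fun ℓ => kdeg N (nodeOut N ℓ)) k' : ℝ) / (E N))
        Filter.atTop (nhds (∑ j' ∈ Finset.Icc 1 K, Q (k', j'))))
    (j₀ k₀ : ℕ) (hj₀1 : 1 ≤ j₀) (hj₀K : j₀ ≤ K) (hk₀1 : 1 ≤ k₀) (hk₀K : k₀ ≤ K)
    (ℓ₀ : (N : ℕ) → Fin (E N)) :
    Filter.Tendsto (fun N : ℕ => ((N + 1 : ℕ) : ℝ) *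
        ((∑ σ : Equiv.Perm (Fin (E N)), ∑ τ : Equiv.Perm (Fin (E N)),
            if nodeOut N (σ (ℓ₀ N)) = nodeIn N (τ (ℓ₀ N)) ∧
                jdeg N (nodeOut N (σ (ℓ₀ N))) = j₀ ∧ kdeg N (nodeOut N (σ (ℓ₀ N))) = k₀
              then wiringWeight (E N) (fun ℓ => kdeg N (nodeOut N ℓ))
                (fun ℓ => jdeg N (nodeIn N ℓ)) Q σ τ
              else 0) /
          Cnorm (E N) (fun ℓ => kdeg N (nodeOut N ℓ)) (fun ℓ => jdeg N (nodeIn N ℓ)) Q))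
      Filter.atTop
      (nhds ((j₀ : ℝ) * (k₀ : ℝ) * P (j₀, k₀) * Q (k₀, j₀) /
        (z ^ 2 * (∑ j' ∈ Finset.Icc 1 K, Q (k₀, j')) *
          ∑ k' ∈ Finset.Icc 1 K, Q (k', j₀)))) := by
  classical
  set k : (N : ℕ) → Fin (E N) → ℕ := fun N ℓ => kdeg N (nodeOut N ℓ) with hk
  set j : (N : ℕ) → Fin (E N) → ℕ := fun N ℓ => jdeg N (nodeIn N ℓ) with hj
  have hQpos' : ∀ k' ∈ Finset.Icc 1 K, ∀ j' ∈ Finset.Icc 1 K, 0 < Q (k', j') := by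
    intro a ha b hb
    rw [Finset.mem_Icc] at ha hb
    exact hQpos a b ha.1 ha.2 hb.1 hb.2
  have hQ1 : ∀ k' ∈ Finset.Icc 1 K, ∀ j' ∈ Finset.Icc 1 K, Q (k', j') ≤ 1 := by
    intro a ha b hb
    rw [← hQsum]
    calc Q (a, b) ≤ ∑ k' ∈ Finset.Icc 1 K, Q (k', b) :=
          Finset.single_le_sum (f := fun k' => Q (k', b)) (fun _ _ => hQ0 _) ha
      _ ≤ _ := Finset.single_le_sum (f := fun j' => ∑ k' ∈ Finset.Icc 1 K, Q (k', j'))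
          (fun _ _ => Finset.sum_nonneg fun _ _ => hQ0 _) hb
  have hk₀ : k₀ ∈ Finset.Icc 1 K := Finset.mem_Icc.mpr ⟨hk₀1, hk₀K⟩
  have hj₀ : j₀ ∈ Finset.Icc 1 K := Finset.mem_Icc.mpr ⟨hj₀1, hj₀K⟩
  have hkI : ∀ N s, k N s ∈ Finset.Icc 1 K := by
    intro N s
    refine Finset.mem_Icc.mpr ⟨?_, (hdeg N _).2⟩
    simp only [hk]
    rw [← hOut N]
    exact Finset.card_pos.mpr ⟨s, by simp⟩
  have hjI : ∀ N s, j N s ∈ Finset.Icc 1 K := by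
    intro N s
    refine Finset.mem_Icc.mpr ⟨?_, (hdeg N _).1⟩
    simp only [hj]
    rw [← hIn N]
    exact Finset.card_pos.mpr ⟨s, by simp⟩
  have hW : ∀ N, 0 < ∑ ρ, permW (E N) (k N) (j N) Q ρ := by
    intro N
    refine Finset.sum_pos (fun ρ _ => ?_) ⟨1, Finset.mem_univ _⟩
    exact Finset.prod_pos fun s _ => hQpos' _ (hkI N s) _ (hjI N _)
  have hEpos : ∀ N, (0 : ℝ) < E N := fun N => by exact_mod_cast hE N
  have hNinf : Filter.Tendsto (fun N : ℕ => (N : ℝ) + 1) Filter.atTop Filter.atTop :=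
    Filter.tendsto_atTop_add_const_right _ _ tendsto_natCast_atTop_atTop
  have hEinf : Filter.Tendsto (fun N : ℕ => (E N : ℝ)) Filter.atTop Filter.atTop := by
    have := hEz.pos_mul_atTop hzpos hNinf
    refine this.congr fun N => ?_
    have : (N : ℝ) + 1 ≠ 0 := by positivity
    field_simp
  set qp := ∑ j' ∈ Finset.Icc 1 K, Q (k₀, j') with hqp
  set qm := ∑ k' ∈ Finset.Icc 1 K, Q (k', j₀) with hqm
  have hqp0 : 0 < qp := Finset.sum_pos (hQpos' k₀ hk₀) ⟨k₀, hk₀⟩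
  have hqm0 : 0 < qm := Finset.sum_pos (fun x hx => hQpos' x hx j₀ hj₀) ⟨k₀, hk₀⟩
  -- convergence of the mean edge-type frequency
  have hB : Filter.Tendsto (fun N : ℕ => ((K : ℝ) ^ 4 * (8 / (E N : ℝ)) +
        ((∑ a ∈ Finset.Icc 1 K, |(stubCount (E N) (k N) a : ℝ) / E N - ∑ b ∈ Finset.Icc 1 K, Q (a, b)|)
        + ∑ b ∈ Finset.Icc 1 K,
          |(stubCount (E N) (j N) b : ℝ) / E N - ∑ a ∈ Finset.Icc 1 K, Q (a, b)|)))
      Filter.atTop (nhds ((K : ℝ) ^ 4 * 0 + ((∑ a ∈ Finset.Icc 1 K, (0 : ℝ)) +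
        ∑ b ∈ Finset.Icc 1 K, (0 : ℝ)))) := by
    refine Filter.Tendsto.add (Filter.Tendsto.const_mul _ (hEinf.const_div_atTop 8))
      (Filter.Tendsto.add (tendsto_finsetSum _ fun a ha => ?_) (tendsto_finsetSum _ fun b hb => ?_))
    · rw [Finset.mem_Icc] at ha
      have := ((heplus a ha.1 ha.2).sub_const (∑ b ∈ Finset.Icc 1 K, Q (a, b))).abs
      simpa using this
    · rw [Finset.mem_Icc] at hb
      have := ((heminus b hb.1 hb.2).sub_const (∑ a ∈ Finset.Icc 1 K, Q (a, b))).abs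
      simpa using this
  simp only [mul_zero, Finset.sum_const_zero, add_zero] at hB
  have hmean : Filter.Tendsto (fun N : ℕ =>
      (∑ ρ, permW (E N) (k N) (j N) Q ρ * edgeCnt (E N) (k N) (j N) ρ (k₀, j₀)) /
        (∑ ρ, permW (E N) (k N) (j N) Q ρ) / E N) Filter.atTop (nhds (Q (k₀, j₀))) := by
    rw [Metric.tendsto_nhds]
    intro ε hε
    obtain ⟨M, hM, hst⟩ := stability K hK Q hQpos' k₀ j₀ hk₀ hj₀ (ε / 2) (by positivity)
    have hMB := hB.const_mul M
    rw [mul_zero] at hMB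
    filter_upwards [hMB.eventually_lt_const (show (0 : ℝ) < ε / 2 by positivity)] with N hN
    rw [Real.dist_eq]
    refine (mean_close (E N) K (hE N) (k N) (j N) Q hQ0 hQ1 (hkI N) (hjI N) (hW N) k₀ j₀ (ε / 2) M hM
      hst).trans_lt ?_
    linarith
  have hpl := heplus k₀ hk₀1 hk₀K
  have hmi := heminus j₀ hj₀1 hj₀K
  have hu' := hu j₀ k₀ hj₀K hk₀K
  have hlim := ((hu'.mul_const ((j₀ : ℝ) * k₀)).mul hmean).div
    (((hEz.pow 2).mul hpl).mul hmi)
    (mul_pos (mul_pos (pow_pos hzpos 2) hqp0) hqm0).ne'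
  have hfin : P (j₀, k₀) * ((j₀ : ℝ) * k₀) * Q (k₀, j₀) / (z ^ 2 * qp * qm)
      = (j₀ : ℝ) * (k₀ : ℝ) * P (j₀, k₀) * Q (k₀, j₀) / (z ^ 2 * qp * qm) := by ring
  rw [← hfin]
  refine hlim.congr' ?_
  filter_upwards [hpl.eventually_const_lt hqp0, hmi.eventually_const_lt hqm0] with N h1 h2
  have hp : 0 < stubCount (E N) (k N) k₀ := by
    rw [Nat.pos_iff_ne_zero]
    intro h
    have h1' : (0 : ℝ) < (stubCount (E N) (k N) k₀ : ℝ) / E N := h1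
    simp [h] at h1'
  have hm : 0 < stubCount (E N) (j N) j₀ := by
    rw [Nat.pos_iff_ne_zero]
    intro h
    have h2' : (0 : ℝ) < (stubCount (E N) (j N) j₀ : ℝ) / E N := h2
    simp [h] at h2'
  have hform := loop_formula (E N) (N + 1) (kdeg N) (jdeg N) (nodeOut N) (nodeIn N) (hOut N) (hIn N)
    k₀ j₀ Q (ℓ₀ N) hp hm (hW N)
  refine Eq.trans ?_ (congrArg (fun x => ((N + 1 : ℕ) : ℝ) * x) hform.symm)
  have hp' : (0 : ℝ) < stubCount (E N) (k N) k₀ := by exact_mod_cast hp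
  have hm' : (0 : ℝ) < stubCount (E N) (j N) j₀ := by exact_mod_cast hm
  have hEN := hEpos N
  have hWN := hW N
  have hN1 : (0 : ℝ) < (N : ℝ) + 1 := by positivity
  simp only [← hk, ← hj, Pi.div_apply, Pi.mul_apply, Pi.pow_apply]
  change _ = ((N + 1 : ℕ) : ℝ) * (_ / ((E N : ℝ) * ((stubCount (E N) (k N) k₀ : ℝ) * (stubCount (E N) (j N) j₀ : ℝ))) *
    ((∑ ρ, permW (E N) (k N) (j N) Q ρ * edgeCnt (E N) (k N) (j N) ρ (k₀, j₀)) /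
      ∑ ρ, permW (E N) (k N) (j N) Q ρ))
  change _ / (_ * ((stubCount (E N) (k N) k₀ : ℝ) / E N) * ((stubCount (E N) (j N) j₀ : ℝ) / E N)) = _
  push_cast
  generalize (∑ ρ, permW (E N) (k N) (j N) Q ρ * edgeCnt (E N) (k N) (j N) ρ (k₀, j₀)) = T
  generalize (∑ ρ, permW (E N) (k N) (j N) Q ρ) = S at hWN ⊢
  field_simp
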